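/- arXiv:2405.19965 — 2 statements merged into one kernel-verified Lean document; each statement's English description precedes it below -/
import Mathlib

section
/- Let q ≥ 3 be a power of an odd prime, let m ≥ 7 with m ≡ 1 (mod 3), and n = (q^m−1)/2. For 2 ≤ i ≤ 6, let δ_i′ be the i-th largest odd q-cyclotomic coset leader modulo 2n. Then the negacyclic BCH code C_{(n,−1,(δ_i′+1)/2,0)} over F_q has dimension exactly i·m; equivalently, the number of odd s ∈ {1,…,2n−1} lying outside ∪_{t=1}^{δ_i′−2} C_t^{2n} equals i·m. -/
open Finset

/-- The `q`-cyclotomic coset of `i` modulo `N`, as a subset of `ZMod N`. -/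
def qCoset (q N i : ℕ) : Set (ZMod N) :=
  Set.range fun j : ℕ => (i : ZMod N) * (q : ZMod N) ^ j

/-- The odd `q`-cyclotomic coset leaders modulo `N`. -/
noncomputable def oddLeaders (q N : ℕ) : Finset ℕ := by
  classical
  exact (Finset.range N).filter fun s => Odd s ∧ ∀ j : ℕ, s ≤ (s * q ^ j) % N

/-- `x` is the `i`-th largest element of the finite set `S` (1-indexed). -/
def IsIthLargest (S : Finset ℕ) (i x : ℕ) : Prop :=
  x ∈ S ∧ (S.filter fun y => x ≤ y).card = i

/-- Evaluation of the polynomial with coefficient vector `c` at the point `x`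
of an extension field. -/
noncomputable def evalAt (F : Type*) {E : Type*} [Field F] [Field E] [Algebra F E]
    (n : ℕ) (x : E) : (Fin n → F) →ₗ[F] E where
  toFun c := ∑ j : Fin n, c j • x ^ (j : ℕ)
  map_add' a b := by simp [add_smul, Finset.sum_add_distrib]
  map_smul' r a := by simp [Finset.smul_sum, smul_smul]

/-- The negacyclic BCH code `C_(n,-1,δ,b)`: all words whose polynomial vanishes at
`γ^(1+2i)` for `b ≤ i ≤ b+δ-2`, where `γ` is a primitive `2n`-th root of unity. -/
noncomputable def negaBCH (F : Type*) {E : Type*} [Field F] [Field E] [Algebra F E]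
    (n : ℕ) (γ : E) (δ b : ℕ) : Submodule F (Fin n → F) :=
  ⨅ i ∈ Finset.Icc b (b + δ - 2), LinearMap.ker (evalAt F n (γ ^ (1 + 2 * i)))

/-- The cyclic BCH code `C_(n,1,δ,b)`: all words whose polynomial vanishes at
`β^i` for `b ≤ i ≤ b+δ-2`, where `β` is a primitive `n`-th root of unity. -/
noncomputable def cyclicBCH (F : Type*) {E : Type*} [Field F] [Field E] [Algebra F E]
    (n : ℕ) (β : E) (δ b : ℕ) : Submodule F (Fin n → F) :=
  ⨅ i ∈ Finset.Icc b (b + δ - 2), LinearMap.ker (evalAt F n (β ^ i))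

/-- The dual code under the standard inner product. -/
def dualCode {F : Type*} [Field F] {n : ℕ} (C : Submodule F (Fin n → F)) :
    Submodule F (Fin n → F) where
  carrier := {y | ∀ c ∈ C, ∑ j, y j * c j = 0}
  add_mem' := by
    intro a b ha hb c hc
    simp only [Set.mem_setOf_eq] at *
    simp [Pi.add_apply, add_mul, Finset.sum_add_distrib, ha c hc, hb c hc]
  zero_mem' := by intro c hc; simp
  smul_mem' := by
    intro r y hy c hc
    simp only [Set.mem_setOf_eq] at *
    simp [Pi.smul_apply, smul_eq_mul, mul_assoc, ← Finset.mul_sum, hy c hc]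

/-- The extended code of a code of length `n`. -/
def extendedCode {F : Type*} [Field F] {n : ℕ} (C : Submodule F (Fin n → F)) :
    Submodule F (Fin (n + 1) → F) where
  carrier := {x | (fun j : Fin n => x j.castSucc) ∈ C ∧ ∑ i, x i = 0}
  add_mem' := by
    intro a b ha hb
    exact ⟨C.add_mem ha.1 hb.1, by simp [Finset.sum_add_distrib, ha.2, hb.2]⟩
  zero_mem' := ⟨C.zero_mem, by simp⟩
  smul_mem' := by
    intro r x hx
    exact ⟨C.smul_mem r hx.1, by simp [← Finset.mul_sum, hx.2]⟩

/-- Hamming weight of a word. -/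
noncomputable def hWt {F : Type*} [Field F] {n : ℕ} (c : Fin n → F) : ℕ := by
  classical exact hammingNorm c

/-- `d` is the minimum Hamming distance of the code `C`. -/
def minDistIs {F : Type*} [Field F] {n : ℕ} (C : Submodule F (Fin n → F)) (d : ℕ) : Prop :=
  IsLeast {w : ℕ | ∃ c ∈ C, c ≠ 0 ∧ hWt c = w} d

/-! ### Cyclotomic cosets and their leaders -/

theorem mem_oddLeaders {q N s : ℕ} :
    s ∈ oddLeaders q N ↔ s < N ∧ Odd s ∧ ∀ j : ℕ, s ≤ (s * q ^ j) % N := by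
  simp [oddLeaders]

theorem natCast_mem_qCoset {q N s t : ℕ} :
    (s : ZMod N) ∈ qCoset q N t ↔ ∃ j : ℕ, t * q ^ j ≡ s [MOD N] := by
  simp only [qCoset, Set.mem_range, ← ZMod.natCast_eq_natCast_iff]
  push_cast
  rfl

theorem pow_modEq_one_of_eq_pow_sub_one {q m N : ℕ} (hq : 1 ≤ q) (hN : N = q ^ m - 1) :
    q ^ m ≡ 1 [MOD N] := by
  subst hN
  exact ((Nat.modEq_iff_dvd' (Nat.one_le_pow _ _ hq)).2 dvd_rfl).symm

theorem pow_modEq_pow_mod {q m N : ℕ} (h : q ^ m ≡ 1 [MOD N]) (x : ℕ) :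
    q ^ x ≡ q ^ (x % m) [MOD N] := by
  conv_lhs => rw [← Nat.div_add_mod x m, pow_add, pow_mul]
  simpa using (h.pow (x / m)).mul_right (q ^ (x % m))

/-- Membership in a common coset is symmetric. -/
theorem modEq_mul_pow_symm {q m N s t j : ℕ} (hm : 1 ≤ m) (h : q ^ m ≡ 1 [MOD N])
    (hst : t * q ^ j ≡ s [MOD N]) : s * q ^ ((m - 1) * j) ≡ t [MOD N] := by
  have h1 := hst.symm.mul_right (q ^ ((m - 1) * j))
  refine h1.trans ?_
  rw [mul_assoc, ← pow_add]
  have : j + (m - 1) * j = m * j := by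
    obtain ⟨m, rfl⟩ := Nat.exists_eq_add_of_le hm
    simp; ring
  rw [this, pow_mul]
  simpa using (h.pow j).mul_left t

theorem exists_oddLeader {q m N s : ℕ} (hm : 1 ≤ m) (hN : Even N) (hq : Odd q)
    (h : q ^ m ≡ 1 [MOD N]) (hN0 : 0 < N) (hs : Odd s) :
    ∃ l ∈ oddLeaders q N, ∃ j, l * q ^ j ≡ s [MOD N] := by
  classical
  have hex : ∃ v, ∃ j, v = (s * q ^ j) % N := ⟨_, 0, rfl⟩
  obtain ⟨j, hj⟩ := Nat.find_spec hex
  have hmin := fun v hv => Nat.find_min' hex (m := v) hv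
  set l := Nat.find hex
  have hlj : s * q ^ j ≡ l [MOD N] := by rw [hj]; exact (Nat.mod_modEq _ _).symm
  refine ⟨l, mem_oddLeaders.2 ⟨hj ▸ Nat.mod_lt _ hN0, ?_, fun i => hmin _ ⟨j + i, ?_⟩⟩,
    _, modEq_mul_pow_symm hm h hlj⟩
  · rw [hj]
    exact (hs.mul (hq.pow)).mod_even hN
  · rw [pow_add, ← mul_assoc]
    exact (hlj.mul_right _).symm

theorem le_of_mem_oddLeaders {q N l s j : ℕ} (hl : l ∈ oddLeaders q N)
    (h : l * q ^ j ≡ s [MOD N]) : l ≤ s := by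
  have := (mem_oddLeaders.1 hl).2.2 j
  rw [h] at this
  exact this.trans (Nat.mod_le _ _)

/-- If the complement `e` of a number dominates all its cyclic shifts, that number is a leader. -/
theorem sub_mem_oddLeaders {q N e : ℕ} (hN : Even N) (he : Odd e) (heN : e < N)
    (h : ∀ j, ∃ e' ≤ e, 0 < e' ∧ e * q ^ j ≡ e' [MOD N]) : N - e ∈ oddLeaders q N := by
  refine mem_oddLeaders.2 ⟨?_, Nat.Even.sub_odd heN.le hN he, fun j => ?_⟩
  · have := he.pos
    omega
  · obtain ⟨e', hle, hpos, he'⟩ := h j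
    have h1 : (N - e) * q ^ j ≡ N - e' [MOD N] := by
      refine Nat.ModEq.add_right_cancel' e' ?_
      refine ((he'.symm).add_left _).trans ?_
      rw [← add_mul, Nat.sub_add_cancel heN.le, Nat.sub_add_cancel (by omega)]
      exact ((Nat.modEq_zero_iff_dvd.2 (dvd_mul_right _ _)).trans
        (Nat.modEq_zero_iff_dvd.2 dvd_rfl).symm)
    rw [h1, Nat.mod_eq_of_lt (by omega)]
    omega

theorem pow_add_pow_add_pow_lt {q M y z : ℕ} (hq : 3 ≤ q) (hy : y < M) (hz : z < M) :
    q ^ M + q ^ y + q ^ z < q ^ (M + 1) - 1 := by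
  obtain ⟨M, rfl⟩ := Nat.exists_eq_add_of_lt (Nat.zero_lt_of_lt hy)
  have h1 : q ^ y ≤ q ^ (0 + M) := Nat.pow_le_pow_right (by omega) (by omega)
  have h2 : q ^ z ≤ q ^ (0 + M) := Nat.pow_le_pow_right (by omega) (by omega)
  have h3 : 1 ≤ q ^ (0 + M) := Nat.one_le_pow _ _ (by omega)
  have h4 : q ^ (0 + M + 1) = q ^ (0 + M) * q := pow_succ ..
  have h5 : q ^ (0 + M + 1 + 1) = q ^ (0 + M) * q * q := by ring
  have h6 : q ^ (0 + M) * 3 ≤ q ^ (0 + M) * q := Nat.mul_le_mul_left _ hq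
  have h7 : q ^ (0 + M) * q * 3 ≤ q ^ (0 + M) * q * q := Nat.mul_le_mul_left _ hq
  omega

theorem pow_add_pow_add_pow_le_pow {q x y z M : ℕ} (hq : 3 ≤ q) (hx : x < M) (hy : y < M)
    (hz : z < M) : q ^ x + q ^ y + q ^ z ≤ q ^ M := by
  obtain ⟨M, rfl⟩ := Nat.exists_eq_add_of_lt (Nat.zero_lt_of_lt hx)
  have h1 : q ^ x ≤ q ^ (0 + M) := Nat.pow_le_pow_right (by omega) (by omega)
  have h2 : q ^ y ≤ q ^ (0 + M) := Nat.pow_le_pow_right (by omega) (by omega)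
  have h3 : q ^ z ≤ q ^ (0 + M) := Nat.pow_le_pow_right (by omega) (by omega)
  have h4 : q ^ (0 + M + 1) = q ^ (0 + M) * q := pow_succ ..
  have h6 : q ^ (0 + M) * 3 ≤ q ^ (0 + M) * q := Nat.mul_le_mul_left _ hq
  omega

theorem pow_add_pow_le_pow {q x y M : ℕ} (hq : 3 ≤ q) (hx : x < M) (hy : y < M) :
    q ^ x + q ^ y ≤ q ^ M :=
  le_trans (Nat.le_add_right _ (q ^ y)) (pow_add_pow_add_pow_le_pow hq hx hy hy)

theorem mod_eq_ite_sub {x m : ℕ} (h : x < 2 * m) :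
    x % m = if x < m then x else x - m := by
  split_ifs with h'
  · exact Nat.mod_eq_of_lt h'
  · rw [Nat.mod_eq_sub_mod (by omega), Nat.mod_eq_of_lt (by omega)]

/-- Each cyclic shift of a word with three ones, separated by gaps `a ≤ b` and `a < c`,
is at most that word. -/
theorem shift_three_ones_le {q a b c j : ℕ} (hq : 3 ≤ q) (ha : 1 ≤ a) (hab : a ≤ b)
    (hac : a < c) (hj : j < a + b + c) :
    q ^ ((a + b + c - 1 + j) % (a + b + c)) + q ^ ((b + c - 1 + j) % (a + b + c)) +
        q ^ ((c - 1 + j) % (a + b + c)) ≤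
      q ^ (a + b + c - 1) + q ^ (b + c - 1) + q ^ (c - 1) := by
  rw [mod_eq_ite_sub (by omega), mod_eq_ite_sub (by omega), mod_eq_ite_sub (by omega)]
  rcases Nat.eq_zero_or_pos j with rfl | hj0
  · rw [if_pos (by omega), if_pos (by omega), if_pos (by omega)]; simp
  rw [if_neg (by omega)]
  by_cases h1 : j = a
  · subst h1
    rw [if_pos (by omega), if_pos (by omega), show b + c - 1 + j = j + b + c - 1 by omega]
    rcases hab.lt_or_eq with h | rfl
    · have := pow_add_pow_le_pow (q := q) (x := j + b + c - 1 + j - (j + b + c)) (y := c - 1 + j)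
        (M := b + c - 1) hq (by omega) (by omega)
      omega
    · have : q ^ (j + j + c - 1 + j - (j + j + c)) ≤ q ^ (c - 1) :=
        Nat.pow_le_pow_right (by omega) (by omega)
      rw [show c - 1 + j = j + c - 1 by omega]
      omega
  by_cases h2 : j = a + b
  · subst h2
    rw [if_neg (by omega), if_pos (by omega), show c - 1 + (a + b) = a + b + c - 1 by omega]
    have := pow_add_pow_le_pow (q := q) (x := a + b + c - 1 + (a + b) - (a + b + c))
        (y := b + c - 1 + (a + b) - (a + b + c)) (M := b + c - 1) hq (by omega) (by omega)
    omega
  have key := fun x y z hx hy hz =>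
    pow_add_pow_add_pow_le_pow (q := q) (x := x) (y := y) (z := z) (M := a + b + c - 1) hq hx hy hz
  refine le_trans (key _ _ _ ?_ ?_ ?_) (by omega)
  all_goals first | omega | (split_ifs <;> omega)

theorem three_ones_mem_oddLeaders {q m a b c : ℕ} (hq : 3 ≤ q) (hqo : Odd q) (ha : 1 ≤ a)
    (hab : a ≤ b) (hac : a < c) (hm : m = a + b + c) :
    (q ^ m - 1) - (q ^ (m - 1) + q ^ (b + c - 1) + q ^ (c - 1)) ∈ oddLeaders q (q ^ m - 1) := by
  subst hm
  have hN : q ^ (a + b + c) ≡ 1 [MOD (q ^ (a + b + c) - 1)] :=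
    pow_modEq_one_of_eq_pow_sub_one (by omega) rfl
  refine sub_mem_oddLeaders ?_ ?_ ?_ fun j => ?_
  · exact hqo.pow.tsub_odd odd_one
  · exact (hqo.pow.add_odd hqo.pow).add_odd hqo.pow
  · have := pow_add_pow_add_pow_lt (q := q) (M := a + b + c - 1) (y := b + c - 1) (z := c - 1)
      hq (by omega) (by omega)
    rwa [Nat.sub_add_cancel (by omega)] at this
  · refine ⟨_, shift_three_ones_le hq ha hab hac (Nat.mod_lt j (by omega)), by positivity, ?_⟩
    rw [add_mul, add_mul, ← pow_add, ← pow_add, ← pow_add]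
    simp only [Nat.add_mod_mod]
    exact ((pow_modEq_pow_mod hN _).add (pow_modEq_pow_mod hN _)).add (pow_modEq_pow_mod hN _)

theorem one_one_mem_oddLeaders {q m : ℕ} (hq : 3 ≤ q) (hqo : Odd q) (hm : 2 ≤ m) :
    (q ^ m - 1) - q ^ (m - 1) ∈ oddLeaders q (q ^ m - 1) := by
  have hN : q ^ m ≡ 1 [MOD (q ^ m - 1)] := pow_modEq_one_of_eq_pow_sub_one (by omega) rfl
  refine sub_mem_oddLeaders (hqo.pow.tsub_odd odd_one) hqo.pow ?_ fun j => ?_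
  · have := pow_add_pow_add_pow_lt (q := q) (M := m - 1) (y := 0) (z := 0)
      hq (by omega) (by omega)
    rw [Nat.sub_add_cancel (by omega)] at this
    omega
  · refine ⟨q ^ ((m - 1 + j) % m), Nat.pow_le_pow_right (by omega) ?_, by positivity, ?_⟩
    · have := Nat.mod_lt (m - 1 + j) (show 0 < m by omega)
      omega
    · rw [← pow_add]
      exact pow_modEq_pow_mod hN _

/-- At least six odd coset leaders are bounded below by the one given here. -/
theorem six_le_card_oddLeaders {q k : ℕ} (hq : 3 ≤ q) (hqo : Odd q) (hk : 2 ≤ k) :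
    6 ≤ ((oddLeaders q (q ^ (3 * k + 1) - 1)).filter fun y =>
      (q ^ (3 * k + 1) - 1) - (q ^ (3 * k) + q ^ (2 * k + 1) + q ^ (k + 2)) ≤ y).card := by
  obtain ⟨k, rfl⟩ := Nat.exists_eq_add_of_le' (show 1 ≤ k by omega)
  have l1 := one_one_mem_oddLeaders hq hqo (m := 3 * (k + 1) + 1) (by omega)
  have l2 := three_ones_mem_oddLeaders hq hqo (m := 3 * (k + 1) + 1) (a := k + 1) (b := k + 1)
    (c := k + 2) (by omega) (by omega) (by omega) (by omega)
  have l3 := three_ones_mem_oddLeaders hq hqo (m := 3 * (k + 1) + 1) (a := k) (b := k + 3)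
    (c := k + 1) (by omega) (by omega) (by omega) (by omega)
  have l4 := three_ones_mem_oddLeaders hq hqo (m := 3 * (k + 1) + 1) (a := k) (b := k + 2)
    (c := k + 2) (by omega) (by omega) (by omega) (by omega)
  have l5 := three_ones_mem_oddLeaders hq hqo (m := 3 * (k + 1) + 1) (a := k) (b := k + 1)
    (c := k + 3) (by omega) (by omega) (by omega) (by omega)
  have l6 := three_ones_mem_oddLeaders hq hqo (m := 3 * (k + 1) + 1) (a := k) (b := k)
    (c := k + 4) (by omega) (by omega) (by omega) (by omega)
  have e6 := pow_add_pow_add_pow_lt (q := q) (M := 3 * (k + 1)) (y := 2 * k + 3) (z := k + 3)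
      hq (by omega) (by omega)
  simp only [Nat.add_sub_cancel, show k + 1 + (k + 2) - 1 = 2 * k + 2 by omega,
    show k + 2 - 1 = k + 1 by omega, show k + 3 + (k + 1) - 1 = 2 * k + 3 by omega,
    show k + 2 + (k + 2) - 1 = 2 * k + 3 by omega,
    show k + 1 + (k + 3) - 1 = 2 * k + 3 by omega, show k + 3 - 1 = k + 2 by omega,
    show k + (k + 4) - 1 = 2 * k + 3 by omega, show k + 4 - 1 = k + 3 by omega]
    at l1 l2 l3 l4 l5 l6
  rw [show 2 * (k + 1) + 1 = 2 * k + 3 by omega, show k + 1 + 2 = k + 3 by omega]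
  have p0 : 0 < q ^ (2 * k + 2) := by positivity
  have p1 : q ^ k < q ^ (k + 1) := Nat.pow_lt_pow_right (by omega) (by omega)
  have p2 : q ^ (k + 1) < q ^ (k + 2) := Nat.pow_lt_pow_right (by omega) (by omega)
  have p3 : q ^ (k + 2) < q ^ (k + 3) := Nat.pow_lt_pow_right (by omega) (by omega)
  have p4 := pow_add_pow_le_pow (q := q) (x := 2 * k + 2) (y := k + 1) (M := 2 * k + 3) hq
    (by omega) (by omega)
  have p5 : 0 < q ^ k := by positivity
  generalize q ^ (3 * (k + 1) + 1) - 1 = N at *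
  generalize q ^ (3 * (k + 1)) = A at *
  generalize q ^ (2 * k + 3) = B at *
  generalize q ^ (2 * k + 2) = C at *
  generalize q ^ (k + 3) = D at *
  generalize q ^ (k + 2) = D' at *
  generalize q ^ (k + 1) = D'' at *
  generalize q ^ k = D''' at *
  have hc : ({N - A, N - (A + C + D''), N - (A + B + D'''), N - (A + B + D''),
      N - (A + B + D'), N - (A + B + D)} : Finset ℕ).card = 6 := by
    repeat rw [Finset.card_insert_of_notMem (by
      simp only [Finset.mem_insert, Finset.mem_singleton]; omega)]
    simp
  rw [← hc]
  refine Finset.card_le_card fun x hx => ?_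
  simp only [Finset.mem_insert, Finset.mem_singleton] at hx
  rw [Finset.mem_filter]
  rcases hx with rfl | rfl | rfl | rfl | rfl | rfl
  all_goals refine ⟨by assumption, by omega⟩

/-- The complement of a leader has a nonzero leading digit. -/
theorem pow_pred_le_sub_of_mem_oddLeaders {q m L : ℕ} (hq : 3 ≤ q) (hm : 1 ≤ m)
    (hL : L ∈ oddLeaders q (q ^ m - 1)) : q ^ (m - 1) ≤ (q ^ m - 1) - L := by
  obtain ⟨hlt, hodd, hmin⟩ := mem_oddLeaders.1 hL
  obtain ⟨m, rfl⟩ := Nat.exists_eq_add_of_le' hm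
  simp only [Nat.add_sub_cancel]
  by_contra! hcon
  have hLpos := hodd.pos
  set N := q ^ (m + 1) - 1 with hN
  have h1 : q ^ (m + 1) = q * q ^ m := pow_succ' ..
  have hpos : 0 < q ^ m := by positivity
  obtain ⟨e, he⟩ : ∃ e, N = L + e := ⟨N - L, by omega⟩
  have h3 : q * (e + 1) ≤ q * q ^ m := Nat.mul_le_mul_left _ (by omega)
  have h4 : q * e < N := by rw [mul_add] at h3; omega
  have h5 : L * q ^ 1 ≡ N - q * e [MOD N] := by
    refine Nat.ModEq.add_right_cancel' (q * e) ?_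
    rw [Nat.sub_add_cancel h4.le]
    have : L * q ^ 1 + q * e = N * q := by rw [he]; ring
    rw [this]
    exact ((Nat.modEq_zero_iff_dvd.2 (dvd_mul_right _ _)).trans
        (Nat.modEq_zero_iff_dvd.2 dvd_rfl).symm)
  have h6 := le_of_mem_oddLeaders hL h5
  have h7 : 2 * e ≤ q * e := Nat.mul_le_mul_right _ (by omega)
  omega

/-- A leader with orbit length a proper divisor of `m` is small. -/
theorem lt_of_dvd_mul_pow_sub_one {q k d L : ℕ} (hq : 3 ≤ q) (hqo : Odd q) (hk : 1 ≤ k)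
    (hd : d ∣ 3 * k + 1) (hd' : d < 3 * k + 1)
    (hL : L ∈ oddLeaders q (q ^ (3 * k + 1) - 1))
    (hdvd : q ^ (3 * k + 1) - 1 ∣ L * (q ^ d - 1)) :
    L < (q ^ (3 * k + 1) - 1) - (q ^ (3 * k) + q ^ (2 * k + 1) + q ^ (k + 2)) := by
  obtain ⟨hlt, hodd, -⟩ := mem_oddLeaders.1 hL
  have hlead := pow_pred_le_sub_of_mem_oddLeaders hq (by omega) hL
  obtain ⟨r, hr⟩ := hd
  have hd0 : 1 ≤ d := Nat.pos_of_ne_zero (by rintro rfl; omega)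
  have hqd : 1 < q ^ d := Nat.one_lt_pow (by omega) (by omega)
  have hgeom : (∑ i ∈ range r, (q ^ d) ^ i) * (q ^ d - 1) = q ^ (3 * k + 1) - 1 := by
    rw [hr, pow_mul]
    have := geom_sum_mul_add (q ^ d - 1) r
    rw [Nat.sub_add_cancel hqd.le] at this
    omega
  set S := ∑ i ∈ range r, (q ^ d) ^ i with hS
  have hSL : S ∣ L := by
    rw [← hgeom] at hdvd
    exact Nat.dvd_of_mul_dvd_mul_right (by omega) hdvd
  have hrodd : Odd r := by
    have h := hodd.of_dvd_nat hSL
    rw [hS, Finset.odd_sum_iff_odd_card_odd, Finset.filter_true_of_mem, card_range] at h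
    · exact h
    · exact fun i _ => hqo.pow.pow
  have hr5 : 5 ≤ r := by
    by_contra! h
    interval_cases r <;> first | omega | exact absurd hrodd (by decide)
  have h5d : 5 * d ≤ 3 * k + 1 := by rw [hr, mul_comm]; exact Nat.mul_le_mul_left _ hr5
  obtain ⟨l, rfl⟩ := hSL
  obtain ⟨c, hc⟩ : ∃ c, q ^ d - 1 = l + c := by
    refine ⟨q ^ d - 1 - l, ?_⟩
    have : S * l < S * (q ^ d - 1) := by rw [hgeom]; exact hlt
    have := Nat.lt_of_mul_lt_mul_left this
    omega
  have hesub : q ^ (3 * k + 1) - 1 - S * l = S * c := by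
    rw [← hgeom, hc, mul_add]; omega
  have hcge : q ^ (d - 1) ≤ c := by
    by_contra! h
    obtain ⟨d, rfl⟩ := Nat.exists_eq_add_of_le' hd0
    rw [hesub] at hlead
    simp only [Nat.add_sub_cancel] at hlead h
    have h1 : q ^ (3 * k) * (q ^ (d + 1) - 1) ≤ c * (q ^ (3 * k + 1) - 1) := by
      rw [← hgeom]
      calc _ ≤ S * c * (q ^ (d + 1) - 1) := Nat.mul_le_mul_right _ hlead
        _ = _ := by ring
    have h2 : (c + 1) * (q ^ (3 * k + 1) - 1) ≤ q ^ d * (q ^ (3 * k + 1) - 1) :=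
      Nat.mul_le_mul_right _ h
    have h3 : q ^ (3 * k) * (q ^ (d + 1) - 1) + q ^ (3 * k) = q ^ (3 * k) * q ^ d * q := by
      obtain ⟨t, ht⟩ := Nat.exists_eq_add_of_le' hqd.le
      rw [ht, Nat.add_sub_cancel, mul_assoc, ← pow_succ, ht]; ring
    have h4 : q ^ d * (q ^ (3 * k + 1) - 1) + q ^ d = q ^ (3 * k) * q ^ d * q := by
      have : 1 ≤ q ^ (3 * k + 1) := Nat.one_le_pow _ _ (by omega)
      obtain ⟨t, ht⟩ := Nat.exists_eq_add_of_le' this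
      rw [ht, Nat.add_sub_cancel, mul_comm (q ^ (3 * k)), mul_assoc, ← pow_succ, ht]; ring
    have h5 : q ^ (3 * k) * 3 ≤ q ^ (3 * k) * q := Nat.mul_le_mul_left _ hq
    have h6 : q ^ (3 * k + 1) = q ^ (3 * k) * q := pow_succ ..
    have h7 : 1 ≤ q ^ (3 * k) := Nat.one_le_pow _ _ (by omega)
    have h8 : 1 ≤ q ^ d := Nat.one_le_pow _ _ (by omega)
    rw [add_mul, one_mul] at h2
    omega
  have hbig : q ^ (3 * k) + q ^ (2 * k + 1) + q ^ (k + 2) < S * q ^ (d - 1) := by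
    obtain ⟨r, rfl⟩ := Nat.exists_eq_add_of_le' (show 4 ≤ r by omega)
    rw [hS, sum_mul, sum_range_succ, sum_range_succ, sum_range_succ, sum_range_succ]
    have hexp : ∀ i, (q ^ d) ^ i * q ^ (d - 1) = q ^ (d * i + (d - 1)) := fun i => by
      rw [← pow_mul, ← pow_add]
    have e1 : d * (r + 4) = d * r + 4 * d := by ring
    have e2 : d * (r + 1) = d * r + d := by ring
    have e3 : d * (r + 2) = d * r + 2 * d := by ring
    have e4 : d * (r + 3) = d * r + 3 * d := by ring
    simp only [hexp, e2, e3, e4]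
    have i1 : q ^ (3 * k) ≤ q ^ (d * r + 3 * d + (d - 1)) :=
      Nat.pow_le_pow_right (by omega) (by omega)
    have i2 : q ^ (2 * k + 1) ≤ q ^ (d * r + 2 * d + (d - 1)) :=
      Nat.pow_le_pow_right (by omega) (by omega)
    have i3 : q ^ (k + 2) ≤ q ^ (d * r + d + (d - 1)) :=
      Nat.pow_le_pow_right (by omega) (by omega)
    have i4 : 0 < q ^ (d * r + (d - 1)) := by positivity
    omega
  have : S * q ^ (d - 1) ≤ S * c := Nat.mul_le_mul_left _ hcge
  omega

theorem dvd_mul_pow_gcd_sub_one {q m N L a b : ℕ} (hq : 1 ≤ q) (hN : N = q ^ m - 1)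
    (hab : a ≤ b) (hcop : N.Coprime q) (h : L * q ^ a ≡ L * q ^ b [MOD N]) :
    N ∣ L * (q ^ (b - a).gcd m - 1) := by
  have h1 : L ≡ L * q ^ (b - a) [MOD N] := by
    refine Nat.ModEq.cancel_right_of_coprime (c := q ^ a) (hcop.pow_right a) ?_
    rwa [mul_assoc, ← pow_add, Nat.sub_add_cancel hab]
  have h2 : N ∣ L * (q ^ (b - a) - 1) := by
    rw [Nat.mul_sub, mul_one]
    exact (Nat.modEq_iff_dvd' (Nat.le_mul_of_pos_right _ (by positivity))).1 h1
  rw [← Nat.pow_sub_one_gcd_pow_sub_one, ← Nat.gcd_mul_left]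
  exact Nat.dvd_gcd h2 (hN ▸ dvd_mul_left _ _)

/-- Large leaders have cosets of full size. -/
theorem mul_pow_injOn_of_le {q k L : ℕ} (hq : 3 ≤ q) (hqo : Odd q) (hk : 1 ≤ k)
    (hL : L ∈ oddLeaders q (q ^ (3 * k + 1) - 1))
    (hle : (q ^ (3 * k + 1) - 1) - (q ^ (3 * k) + q ^ (2 * k + 1) + q ^ (k + 2)) ≤ L)
    {a b : ℕ} (ha : a < 3 * k + 1) (hb : b < 3 * k + 1)
    (h : L * q ^ a ≡ L * q ^ b [MOD (q ^ (3 * k + 1) - 1)]) : a = b := by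
  have hcop : (q ^ (3 * k + 1) - 1).Coprime q :=
    Nat.Coprime.coprime_dvd_right (dvd_pow_self q (by omega : 3 * k + 1 ≠ 0))
      ((Nat.coprime_self_sub_left (Nat.one_le_pow _ _ (by omega))).2 (Nat.coprime_one_left _))
  wlog hab : a ≤ b generalizing a b
  · exact (this hb ha h.symm (le_of_not_ge hab)).symm
  by_contra hne
  have h1 := dvd_mul_pow_gcd_sub_one (by omega) rfl hab hcop h
  have h2 : (b - a).gcd (3 * k + 1) ≤ b - a := Nat.gcd_le_left _ (by omega)
  exact absurd (lt_of_dvd_mul_pow_sub_one hq hqo hk (Nat.gcd_dvd_right _ _) (by omega) hL h1)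
    (by omega)

theorem natCast_mem_iUnion_qCoset {q N s a b : ℕ} :
    (s : ZMod N) ∈ ⋃ t ∈ Set.Icc a b, qCoset q N t ↔
      ∃ t j : ℕ, (a ≤ t ∧ t ≤ b) ∧ t * q ^ j ≡ s [MOD N] := by
  simp only [Set.mem_iUnion, natCast_mem_qCoset, Set.mem_Icc]
  constructor
  · rintro ⟨t, ht, j, h⟩
    exact ⟨t, j, ht, h⟩
  · rintro ⟨t, j, ht, h⟩
    exact ⟨t, ht, j, h⟩

/-- The number of odd residues outside the cosets of `1, …, δ - 2`, for `δ` an odd leader. -/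
theorem ncard_odd_notMem_iUnion_qCoset {q m N δ : ℕ} (hm : 1 ≤ m) (hN : Even N) (hqo : Odd q)
    (h : q ^ m ≡ 1 [MOD N]) (hδ : δ ∈ oddLeaders q N)
    (hfull : ∀ L ∈ oddLeaders q N, δ ≤ L → ∀ a < m, ∀ b < m,
      L * q ^ a ≡ L * q ^ b [MOD N] → a = b) :
    {s : ℕ | 1 ≤ s ∧ s ≤ N - 1 ∧ Odd s ∧
      (s : ZMod N) ∉ ⋃ t ∈ Set.Icc 1 (δ - 2), qCoset q N t}.ncard =
    ((oddLeaders q N).filter fun y => δ ≤ y).card * m := by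
  obtain ⟨hδN, hδo, -⟩ := mem_oddLeaders.1 hδ
  have hset : {s : ℕ | 1 ≤ s ∧ s ≤ N - 1 ∧ Odd s ∧
      (s : ZMod N) ∉ ⋃ t ∈ Set.Icc 1 (δ - 2), qCoset q N t} =
      ((((oddLeaders q N).filter fun y => δ ≤ y) ×ˢ range m).image
        fun p => p.1 * q ^ p.2 % N : Finset ℕ) := by
    ext s
    simp only [Set.mem_ofPred_eq, natCast_mem_iUnion_qCoset, coe_image, Set.mem_image,
      mem_coe, mem_product, mem_filter, mem_range, Prod.exists]
    constructor
    · rintro ⟨h1, h2, hs, hns⟩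
      obtain ⟨L, hL, j, hj⟩ := exists_oddLeader hm hN hqo h (by omega) hs
      have hLo := (mem_oddLeaders.1 hL).2.1
      refine ⟨L, j % m, ⟨⟨hL, ?_⟩, Nat.mod_lt _ (by omega)⟩, ?_⟩
      · by_contra! hlt
        refine hns ⟨L, j, ⟨hLo.pos, ?_⟩, hj⟩
        obtain ⟨x, rfl⟩ := hLo
        obtain ⟨y, rfl⟩ := hδo
        omega
      · have : L * q ^ (j % m) ≡ s [MOD N] := ((pow_modEq_pow_mod h j).mul_left L).symm.trans hj
        rw [this, Nat.mod_eq_of_lt (by omega)]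
    · rintro ⟨L, j, ⟨⟨hL, hLδ⟩, hj⟩, rfl⟩
      have hLo := (mem_oddLeaders.1 hL).2.1
      have hodd : Odd (L * q ^ j % N) := (hLo.mul hqo.pow).mod_even hN
      refine ⟨hodd.pos, Nat.le_sub_one_of_lt (Nat.mod_lt _ (by omega)), hodd, ?_⟩
      rintro ⟨t, i, ⟨ht1, ht2⟩, hti⟩
      have h1 := modEq_mul_pow_symm hm h (hti.trans (Nat.mod_modEq _ _))
      rw [mul_assoc, ← pow_add] at h1
      have := le_of_mem_oddLeaders hL h1
      omega
  rw [hset, Set.ncard_coe_finset, card_image_of_injOn, card_product, card_range]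
  rintro ⟨L, a⟩ hLa ⟨L', b⟩ hLb hEq
  simp only [mem_coe, mem_product, mem_filter, mem_range] at hLa hLb
  replace hEq : L * q ^ a ≡ L' * q ^ b [MOD N] := hEq
  have h1 := modEq_mul_pow_symm hm h hEq
  have h2 := modEq_mul_pow_symm hm h hEq.symm
  rw [mul_assoc, ← pow_add] at h1 h2
  obtain rfl : L = L' :=
    le_antisymm (le_of_mem_oddLeaders hLa.1.1 h2) (le_of_mem_oddLeaders hLb.1.1 h1)
  rw [hfull L hLa.1.1 hLa.1.2 a hLa.2 b hLb.2 hEq]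

theorem card_filter_odd_range (n : ℕ) : ((range (2 * n)).filter Odd).card = n := by
  induction n with
  | zero => simp
  | succ n ih =>
    rw [show 2 * (n + 1) = 2 * n + 1 + 1 by ring, range_add_one, range_add_one,
      filter_insert, if_pos (odd_two_mul_add_one n), filter_insert,
      if_neg (by simp), card_insert_of_notMem (by simp), ih]

/-! ### Codes with a Frobenius-stable set of zeros -/

section Polynomial

open Polynomial

variable {F E : Type*} [Field F] [Field E] [Algebra F E]

theorem evalAt_eq_aeval {n : ℕ} (x : E) (c : Fin n → F) :
    evalAt F n x c = aeval x ((degreeLTEquiv F n).symm c : F[X]) := by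
  have : ((degreeLTEquiv F n).symm c : F[X]) = ∑ j : Fin n, monomial (j : ℕ) (c j) := rfl
  rw [this, map_sum]
  simp [evalAt, aeval_monomial, Algebra.smul_def]

theorem evalAt_pow_card [Fintype F] {n : ℕ} (x : E) (c : Fin n → F) :
    evalAt F n (x ^ Fintype.card F) c = evalAt F n x c ^ Fintype.card F := by
  have := aeval_algHom_apply (FiniteField.frobeniusAlgHom F E) x
    ((degreeLTEquiv F n).symm c : F[X])
  simpa [evalAt_eq_aeval, FiniteField.frobeniusAlgHom_apply] using this

theorem mem_range_algebraMap_of_pow_card_eq [Fintype F] {x : E} (hx : x ^ Fintype.card F = x) :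
    x ∈ Set.range (algebraMap F E) := by
  have hcard : 1 < Fintype.card F := Fintype.one_lt_card
  have hsplits : (X ^ Fintype.card F - X : F[X]).Splits := by
    rw [splits_iff_card_roots, FiniteField.roots_X_pow_card_sub_X,
      FiniteField.X_pow_card_sub_X_natDegree_eq F hcard]
    rfl
  exact hsplits.mem_range_of_isRoot (FiniteField.X_pow_card_sub_X_ne_zero F hcard)
    (by simp [hx])

/-- The monic polynomial with a Frobenius-stable set of simple roots descends. -/
theorem exists_map_eq_prod_X_sub_C [Fintype F] (Z : Finset E)
    (hZ : ∀ z ∈ Z, z ^ Fintype.card F ∈ Z) :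
    ∃ g : F[X], g.map (algebraMap F E) = ∏ z ∈ Z, (X - C z) ∧ g.natDegree = Z.card ∧ g.Monic := by
  classical
  set φ := (FiniteField.frobeniusAlgHom F E : E →+* E) with hφ
  have hφa : ∀ x, φ x = x ^ Fintype.card F := fun x => by
    simp [hφ, FiniteField.frobeniusAlgHom_apply]
  have himg : Z.image φ = Z := by
    refine Finset.eq_of_subset_of_card_le ?_ ?_
    · intro x hx
      obtain ⟨z, hz, rfl⟩ := Finset.mem_image.1 hx
      rw [hφa]
      exact hZ z hz
    · rw [Finset.card_image_of_injective _ φ.injective]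
  have hmap : (∏ z ∈ Z, (X - C z)).map φ = ∏ z ∈ Z, (X - C z) := by
    conv_rhs => rw [← himg, Finset.prod_image (fun _ _ _ _ h => φ.injective h)]
    simp [Polynomial.map_prod]
  have hmonic : (∏ z ∈ Z, (X - C z)).Monic := monic_prod_of_monic _ _ fun z _ => monic_X_sub_C z
  have hlift : ∏ z ∈ Z, (X - C z) ∈ lifts (algebraMap F E) := by
    rw [lifts_iff_coeff_lifts]
    intro i
    refine mem_range_algebraMap_of_pow_card_eq ?_
    rw [← hφa, ← coeff_map, hmap]
  obtain ⟨g, h1, h2, h3⟩ := lifts_and_natDegree_eq_and_monic hlift hmonic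
  refine ⟨g, h1, ?_, h3⟩
  rw [h2, natDegree_prod_of_monic _ _ fun z _ => monic_X_sub_C z]
  simp

theorem forall_aeval_eq_zero_iff_dvd {Z : Finset E} {g : F[X]}
    (hg : g.map (algebraMap F E) = ∏ z ∈ Z, (X - C z)) (p : F[X]) :
    (∀ z ∈ Z, aeval z p = 0) ↔ g ∣ p := by
  rw [← map_dvd_map' (algebraMap F E), hg]
  constructor
  · intro h
    refine Finset.prod_dvd_of_coprime ?_ fun z hz => ?_
    · exact (pairwise_coprime_X_sub_C (K := E) (s := id) Function.injective_id).set_pairwise _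
    · rw [dvd_iff_isRoot, IsRoot, eval_map_algebraMap]
      exact h z hz
  · intro h z hz
    rw [← eval_map_algebraMap]
    have hdvd : X - C z ∣ ∏ z ∈ Z, (X - C z) := Finset.dvd_prod_of_mem (fun z => X - C z) hz
    exact dvd_iff_isRoot.1 (hdvd.trans h)

theorem finrank_iInf_ker_evalAt [Fintype F] {n : ℕ} (Z : Finset E)
    (hZ : ∀ z ∈ Z, z ^ Fintype.card F ∈ Z) (hcard : Z.card ≤ n) :
    Module.finrank F (⨅ z ∈ Z, LinearMap.ker (evalAt F n z) : Submodule F (Fin n → F)) =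
      n - Z.card := by
  obtain ⟨g, hg, hdeg, hmon⟩ := exists_map_eq_prod_X_sub_C Z hZ
  have mul_mem_degreeLT_iff : ∀ r, g * r ∈ degreeLT F n ↔ r ∈ degreeLT F (n - Z.card) := by
    intro r
    rcases eq_or_ne r 0 with rfl | hr
    · simp
    · rw [mem_degreeLT, mem_degreeLT, ← natDegree_lt_iff_degree_lt (mul_ne_zero hmon.ne_zero hr),
        ← natDegree_lt_iff_degree_lt hr, natDegree_mul hmon.ne_zero hr, hdeg]
      omega
  set ι : (Fin n → F) →ₗ[F] F[X] :=
    (degreeLT F n).subtype ∘ₗ ((degreeLTEquiv F n).symm : (Fin n → F) →ₗ[F] degreeLT F n)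
  have hι : Function.Injective ι :=
    (Submodule.injective_subtype _).comp (degreeLTEquiv F n).symm.injective
  have hmul : Function.Injective (LinearMap.mulLeft F g) :=
    fun a b h => mul_left_cancel₀ hmon.ne_zero h
  have hmapeq : (⨅ z ∈ Z, LinearMap.ker (evalAt F n z) : Submodule F (Fin n → F)).map ι =
      (degreeLT F (n - Z.card)).map (LinearMap.mulLeft F g) := by
    ext p
    simp only [Submodule.mem_map, Submodule.mem_iInf, LinearMap.mem_ker, LinearMap.mulLeft_apply,
      evalAt_eq_aeval, forall_aeval_eq_zero_iff_dvd hg]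
    constructor
    · rintro ⟨c, ⟨r, hr⟩, rfl⟩
      refine ⟨r, ?_, hr.symm⟩
      have hlt := ((degreeLTEquiv F n).symm c).2
      rw [hr] at hlt
      exact (mul_mem_degreeLT_iff r).1 hlt
    · rintro ⟨r, hr, rfl⟩
      have hlt := (mul_mem_degreeLT_iff r).2 hr
      refine ⟨degreeLTEquiv F n ⟨_, hlt⟩, ?_, ?_⟩
      · simp
      · simp [ι]
  rw [(Submodule.equivMapOfInjective ι hι _).finrank_eq, hmapeq,
    ← (Submodule.equivMapOfInjective _ hmul _).finrank_eq,
    (degreeLTEquiv F (n - Z.card)).finrank_eq]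
  simp

end Polynomial

/-- The dimension of a narrow-sense negacyclic BCH code, in terms of uncovered odd residues. -/
theorem finrank_negaBCH {F E : Type*} [Field F] [Fintype F] [Field E] [Algebra F E]
    {q n δ : ℕ} (hF : Fintype.card F = q) (hqo : Odd q)
    {γ : E} (hγ : IsPrimitiveRoot γ (2 * n)) (hδo : Odd δ) (hδ : 3 ≤ δ) (hδN : δ < 2 * n) :
    Module.finrank F (negaBCH F n γ ((δ + 1) / 2) 0) =
      {s : ℕ | 1 ≤ s ∧ s ≤ 2 * n - 1 ∧ Odd s ∧
        (s : ZMod (2 * n)) ∉ ⋃ t ∈ Set.Icc 1 (δ - 2), qCoset q (2 * n) t}.ncard := by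
  classical
  have hN : Even (2 * n) := even_two_mul n
  have hγpow : ∀ {a b : ℕ}, a ≡ b [MOD 2 * n] → γ ^ a = γ ^ b := fun {a b} hab => by
    rw [← pow_mod_orderOf γ a, ← pow_mod_orderOf γ b, ← hγ.eq_orderOf, hab]
  let P : ℕ → Prop := fun s => ∃ t j : ℕ, (1 ≤ t ∧ t ≤ δ - 2) ∧ t * q ^ j ≡ s [MOD 2 * n]
  set T := ((range (2 * n)).filter Odd).filter P with hT
  have hTcard : T.card ≤ n := (card_filter_le _ _).trans (card_filter_odd_range n).le
  have hU : {s : ℕ | 1 ≤ s ∧ s ≤ 2 * n - 1 ∧ Odd s ∧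
      (s : ZMod (2 * n)) ∉ ⋃ t ∈ Set.Icc 1 (δ - 2), qCoset q (2 * n) t}.ncard = n - T.card := by
    have hset : {s : ℕ | 1 ≤ s ∧ s ≤ 2 * n - 1 ∧ Odd s ∧
        (s : ZMod (2 * n)) ∉ ⋃ t ∈ Set.Icc 1 (δ - 2), qCoset q (2 * n) t} =
        (((range (2 * n)).filter Odd).filter fun s => ¬ P s : Finset ℕ) := by
      ext s
      simp only [Set.mem_ofPred_eq, natCast_mem_iUnion_qCoset, coe_filter, mem_filter, mem_range, P]
      constructor
      · rintro ⟨h1, h2, h3, h4⟩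
        exact ⟨⟨by omega, h3⟩, h4⟩
      · rintro ⟨⟨h1, h2⟩, h3⟩
        exact ⟨h2.pos, by omega, h2, h3⟩
    rw [hset, Set.ncard_coe_finset]
    have := card_filter_add_card_filter_not (s := (range (2 * n)).filter Odd) P
    rw [card_filter_odd_range, ← hT] at this
    omega
  set Z := T.image (γ ^ ·) with hZ
  have hZcard : Z.card = T.card := by
    refine card_image_of_injOn fun a ha b hb hab => ?_
    simp only [hT, mem_coe, mem_filter, mem_range] at ha hb
    exact hγ.pow_inj ha.1.1 hb.1.1 hab
  have hcode : negaBCH F n γ ((δ + 1) / 2) 0 = ⨅ z ∈ Z, LinearMap.ker (evalAt F n z) := by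
    ext c
    simp only [negaBCH, Submodule.mem_iInf, LinearMap.mem_ker]
    constructor
    · intro hc z hz
      simp only [hZ, hT, mem_image, mem_filter, mem_range] at hz
      obtain ⟨s, ⟨⟨hsN, hso⟩, t, j, ⟨ht1, ht2⟩, hts⟩, rfl⟩ := hz
      have hto : Odd t := by
        have h1 := hts.of_dvd (even_iff_two_dvd.1 hN)
        have h2 : Odd (t * q ^ j) := by
          rw [Nat.odd_iff] at hso ⊢
          rw [← hso]
          exact h1
        exact (Nat.odd_mul.1 h2).1
      obtain ⟨u, rfl⟩ := hto
      rw [← hγpow hts, pow_mul]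
      have h0 : evalAt F n (γ ^ (2 * u + 1)) c = 0 := by
        rw [add_comm]
        exact hc u (mem_Icc.2 ⟨by omega, by omega⟩)
      induction j generalizing s with
      | zero => simpa using h0
      | succ j ih =>
        have := evalAt_pow_card (F := F) ((γ ^ (2 * u + 1)) ^ q ^ j) c
        rw [hF, ← pow_mul, ← pow_succ] at this
        rw [this, ih ((2 * u + 1) * q ^ j % (2 * n)) (Nat.mod_lt _ (by omega))
          (((odd_two_mul_add_one u).mul hqo.pow).mod_even hN) (Nat.mod_modEq _ _).symm]
        exact zero_pow hqo.pos.ne'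
    · intro hc i hi
      have hi' := (mem_Icc.1 hi).2
      refine hc _ (mem_image.2 ⟨1 + 2 * i, ?_, rfl⟩)
      obtain ⟨u, rfl⟩ := hδo
      rw [hT, mem_filter, mem_filter, mem_range]
      exact ⟨⟨by omega, by rw [add_comm]; exact odd_two_mul_add_one i⟩,
        1 + 2 * i, 0, ⟨by omega, by omega⟩, by simp [Nat.ModEq.refl]⟩
  rw [hcode, hU, ← hZcard]
  refine finrank_iInf_ker_evalAt Z (fun z hz => ?_) (hZcard.trans_le hTcard)
  simp only [hZ, hT, mem_image, mem_filter, mem_range] at hz ⊢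
  obtain ⟨s, ⟨⟨hsN, hso⟩, t, j, ht, hts⟩, rfl⟩ := hz
  refine ⟨s * q % (2 * n), ⟨⟨Nat.mod_lt _ (by omega), (hso.mul hqo).mod_even hN⟩,
    t, j + 1, ht, ?_⟩, ?_⟩
  · rw [pow_succ, ← mul_assoc]
    exact (hts.mul_right q).trans (Nat.mod_modEq _ _).symm
  · rw [hF, ← pow_mul]
    exact hγpow (Nat.mod_modEq _ _)

theorem IsIthLargest.le_of_le_card {S : Finset ℕ} {i x v : ℕ} (h : IsIthLargest S i x)
    (hv : i ≤ (S.filter fun y => v ≤ y).card) : v ≤ x := by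
  by_contra! hlt
  have hsub : insert x (S.filter fun y => v ≤ y) ⊆ S.filter fun y => x ≤ y := by
    intro y hy
    rw [mem_insert, mem_filter] at hy
    rw [mem_filter]
    rcases hy with rfl | ⟨hy, hvy⟩
    · exact ⟨h.1, le_rfl⟩
    · exact ⟨hy, by omega⟩
  have := card_le_card hsub
  rw [card_insert_of_notMem (by simp [hlt]), h.2] at this
  omega

theorem stmt_10 (q m n i δ' : ℕ)
    (hq : ∃ p e : ℕ, p.Prime ∧ Odd p ∧ 0 < e ∧ q = p ^ e)
    (hq3 : 3 ≤ q) (hm : 7 ≤ m) (hm3 : m % 3 = 1) (hn : 2 * n = q ^ m - 1)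
    (hi1 : 2 ≤ i) (hi2 : i ≤ 6)
    (hδ' : IsIthLargest (oddLeaders q (2 * n)) i δ')
    (F E : Type*) [Field F] [Fintype F] [Field E] [Algebra F E]
    (hF : Fintype.card F = q)
    (γ : E) (hγ : IsPrimitiveRoot γ (2 * n)) :
    Module.finrank F (negaBCH F n γ ((δ' + 1) / 2) 0) = i * m ∧
    {s : ℕ | 1 ≤ s ∧ s ≤ 2 * n - 1 ∧ Odd s ∧
      (s : ZMod (2 * n)) ∉ ⋃ t ∈ Set.Icc 1 (δ' - 2), qCoset q (2 * n) t}.ncard = i * m := by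
  have hqo : Odd q := by
    obtain ⟨p, e, -, hp, -, rfl⟩ := hq
    exact hp.pow
  obtain ⟨k, rfl⟩ : ∃ k, m = 3 * k + 1 := ⟨m / 3, by omega⟩
  have hone := pow_modEq_one_of_eq_pow_sub_one (m := 3 * k + 1) (by omega) hn
  have hge : (q ^ (3 * k + 1) - 1) - (q ^ (3 * k) + q ^ (2 * k + 1) + q ^ (k + 2)) ≤ δ' := by
    refine hδ'.le_of_le_card (hi2.trans ?_)
    rw [hn]
    exact six_le_card_oddLeaders hq3 hqo (by omega)
  obtain ⟨hlt, hodd, -⟩ := mem_oddLeaders.1 hδ'.1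
  have hδ3 : 3 ≤ δ' := by
    have h1 : q ^ (2 * k + 1) + q ^ (k + 2) ≤ q ^ (3 * k) :=
      pow_add_pow_le_pow hq3 (by omega) (by omega)
    have h2 : q ^ (3 * k + 1) = q ^ (3 * k) * q := pow_succ ..
    have h3 : q ^ (3 * k) * 3 ≤ q ^ (3 * k) * q := Nat.mul_le_mul_left _ hq3
    have h4 : q ^ 2 ≤ q ^ (3 * k) := Nat.pow_le_pow_right (by omega) (by omega)
    have h5 : 3 * 3 ≤ q ^ 2 := by rw [sq]; exact Nat.mul_le_mul hq3 hq3
    omega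
  have hcount := ncard_odd_notMem_iUnion_qCoset (by omega) (even_two_mul n) hqo hone hδ'.1
    (fun L hL hδL a ha b hb hab => by
      rw [hn] at hL hab
      exact mul_pow_injOn_of_le hq3 hqo (by omega) hL (hge.trans hδL) ha hb hab)
  rw [hδ'.2] at hcount
  exact ⟨(finrank_negaBCH hF hqo hγ hodd hδ3 hlt).trans hcount, hcount⟩
end

section
/- Let q ≥ 3 be a power of an odd prime, m ≥ 2, and n = (q^m−1)/2. Let b ≥ 1 and δ ≥ 2 be integers with 1+2b ≤ ⌊(b+δ−2)/q⌋, and with 1 ≤ 1+2(b+δ−2) ≤ q^{(m+1)/2} − 1 if m is odd, respectively 1 ≤ 1+2(b+δ−2) ≤ 2q^{m/2} − 1 if m is even. Then the negacyclic BCH codes satisfy C_{(n,−1,δ,b)} = C_{(n,−1,b+δ,0)}, i.e. ∪_{i=b}^{b+δ−2} C_{1+2i}^{2n} = ∪_{i=0}^{b+δ−2} C_{1+2i}^{2n}, and the dimension of C_{(n,−1,δ,b)} equals n − m·⌈(2δ+2b−3)(q−1)/(2q)⌉. -/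
open Finset

section CyclotomicCosets

/-- Congruent representatives in `{1, …, N}` coincide. -/
lemma Nat.ModEq.eq_of_pos_of_le {a b N : ℕ} (h : a ≡ b [MOD N])
    (ha : 0 < a) (haN : a ≤ N) (hb : 0 < b) (hbN : b ≤ N) : a = b := by
  have h1 := (Nat.modEq_iff_dvd.1 h)
  have h2 : ((b : ℤ) - a) = 0 := by
    apply Int.eq_zero_of_abs_lt_dvd h1
    rw [abs_lt]
    omega
  omega

lemma pow_modEq_one_pow_sub_one {q : ℕ} (hq : 0 < q) (m : ℕ) :
    q ^ m ≡ 1 [MOD q ^ m - 1] :=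
  ((Nat.modEq_iff_dvd' (Nat.one_le_pow _ _ hq)).2 dvd_rfl).symm

/-- The range of integers in which odd non-multiples of `q` are representatives of distinct
`q`-cyclotomic cosets modulo `q ^ m - 1` of full size `m`. -/
def InLeaderRange (q m s : ℕ) : Prop :=
  (Odd m → s ≤ q ^ ((m + 1) / 2) - 1) ∧ (Even m → s ≤ 2 * q ^ (m / 2) - 1)

lemma InLeaderRange.mono {q m s t : ℕ} (h : InLeaderRange q m t) (hst : s ≤ t) :
    InLeaderRange q m s :=
  ⟨fun hm => hst.trans (h.1 hm), fun hm => hst.trans (h.2 hm)⟩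

lemma InLeaderRange.le_pow_sub_one {q m s : ℕ} (h : InLeaderRange q m s) (hq : 3 ≤ q)
    (hm : 2 ≤ m) : s ≤ q ^ m - 1 := by
  rcases Nat.even_or_odd m with he | ho
  · refine (h.2 he).trans (Nat.sub_le_sub_right ?_ 1)
    calc 2 * q ^ (m / 2) ≤ q * q ^ (m / 2) := Nat.mul_le_mul_right _ (by omega)
      _ = q ^ (m / 2 + 1) := by ring
      _ ≤ q ^ m := Nat.pow_le_pow_right (by omega) (by omega)
  · exact (h.1 ho).trans (Nat.sub_le_sub_right (Nat.pow_le_pow_right (by omega) (by omega)) 1)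

/-- Within the leader range, a shift by at most half a period never leads to a
non-multiple of `q`. -/
lemma InLeaderRange.not_mul_pow_modEq {q m s t j : ℕ} (hq : 3 ≤ q) (hqo : Odd q) (hm : 2 ≤ m)
    (hs : InLeaderRange q m s) (ht : InLeaderRange q m t) (hso : Odd s)
    (hqs : ¬ q ∣ s) (hqt : ¬ q ∣ t) (hj : 0 < j) (hjm : 2 * j ≤ m) :
    ¬ s * q ^ j ≡ t [MOD q ^ m - 1] := by
  intro h
  have hs0 : 0 < s := hso.pos
  have ht0 : 0 < t := Nat.pos_of_ne_zero fun h0 => hqt (h0 ▸ dvd_zero q)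
  have htN := ht.le_pow_sub_one hq hm
  have hpos : ∀ k, 0 < q ^ k := fun k => Nat.pow_pos (by omega)
  have small : ¬ s * q ^ j < q ^ m := fun hlt => hqt <| by
    rw [← h.eq_of_pos_of_le (Nat.mul_pos hs0 (hpos j)) (by omega) ht0 htN]
    exact (dvd_pow_self q hj.ne').mul_left s
  rcases Nat.even_or_odd' m with ⟨r, rfl | rfl⟩
  · have hs2 := hs.2 ⟨r, by ring⟩
    have ht2 := ht.2 ⟨r, by ring⟩
    rw [Nat.mul_div_cancel_left r two_pos] at hs2 ht2
    have hr := hpos r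
    rcases (by omega : j < r ∨ j = r) with hjr | rfl
    · refine small ?_
      calc s * q ^ j < (q * q ^ r) * q ^ j :=
            Nat.mul_lt_mul_of_pos_right (by
              have := Nat.mul_le_mul_right (q ^ r) hq
              omega) (hpos j)
        _ = q ^ (r + 1 + j) := by ring
        _ ≤ q ^ (2 * r) := Nat.pow_le_pow_right (by omega) (by omega)
    · have hsq : q ^ (2 * j) = q ^ j * q ^ j := by ring
      rcases lt_or_ge s (q ^ j) with hlt | hge
      · exact small (hsq ▸ Nat.mul_lt_mul_of_pos_right hlt hr)
      · obtain ⟨c, rfl⟩ := Nat.exists_eq_add_of_le hge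
        have hq3j : 3 ≤ q ^ j := hq.trans (Nat.le_self_pow hj.ne' q)
        have h1 : (q ^ j + c) * q ^ j ≡ 1 + c * q ^ j [MOD q ^ (2 * j) - 1] := by
          have := (pow_modEq_one_pow_sub_one (by omega : 0 < q) (2 * j)).add_right (c * q ^ j)
          rwa [hsq, ← add_mul, ← hsq] at this
        have h2 : 1 + c * q ^ j = t := by
          refine (h1.symm.trans h).eq_of_pos_of_le (by omega) ?_ ht0 htN
          have : (c + 1) * q ^ j ≤ q ^ j * q ^ j := Nat.mul_le_mul_right _ (by omega)
          rw [hsq]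
          rw [add_mul] at this
          omega
        have hc : c < 2 := by
          by_contra! hc
          have : 2 * q ^ j ≤ c * q ^ j := Nat.mul_le_mul_right _ hc
          omega
        interval_cases c
        · exact hqs (by simpa using dvd_pow_self q hj.ne')
        · exact (Nat.not_odd_iff_even.2 (hqo.pow.add_odd odd_one)) hso
  · have hs1 := hs.1 ⟨r, rfl⟩
    rw [show (2 * r + 1 + 1) / 2 = r + 1 by omega] at hs1
    have hr := hpos (r + 1)
    refine small ?_
    calc s * q ^ j < q ^ (r + 1) * q ^ j := Nat.mul_lt_mul_of_pos_right (by omega) (hpos j)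
      _ = q ^ (r + 1 + j) := by ring
      _ ≤ q ^ (2 * r + 1) := Nat.pow_le_pow_right (by omega) (by omega)

lemma InLeaderRange.eq_and_eq_of_modEq_of_le {q m s t i j : ℕ} (hq : 3 ≤ q) (hqo : Odd q)
    (hm : 2 ≤ m) (hs : InLeaderRange q m s) (ht : InLeaderRange q m t) (hso : Odd s)
    (hto : Odd t) (hqs : ¬ q ∣ s) (hqt : ¬ q ∣ t) (hj : j < m) (hij : i ≤ j)
    (h : s * q ^ i ≡ t * q ^ j [MOD q ^ m - 1]) : s = t ∧ i = j := by
  obtain ⟨d, rfl⟩ := Nat.exists_eq_add_of_le hij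
  have hone := pow_modEq_one_pow_sub_one (by omega : 0 < q) m
  have hcop : Nat.gcd (q ^ m - 1) (q ^ i) = 1 := by
    have : Nat.Coprime (q ^ m) (q ^ m - 1) :=
      (Nat.coprime_self_sub_right (Nat.one_le_pow _ _ (by omega))).2 (Nat.coprime_one_right _)
    exact ((Nat.Coprime.of_dvd_left (dvd_pow_self q (by omega)) this).pow_left i).symm
  have h' : s ≡ t * q ^ d [MOD q ^ m - 1] := by
    refine Nat.ModEq.cancel_right_of_coprime hcop ?_
    rwa [mul_assoc, ← pow_add, add_comm d i]
  rcases Nat.eq_zero_or_pos d with rfl | hd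
  · refine ⟨?_, rfl⟩
    rw [pow_zero, mul_one] at h'
    exact h'.eq_of_pos_of_le hso.pos (hs.le_pow_sub_one hq hm) hto.pos (ht.le_pow_sub_one hq hm)
  · exfalso
    rcases le_or_gt (2 * d) m with hdm | hdm
    · exact ht.not_mul_pow_modEq hq hqo hm hs hto hqt hqs hd hdm h'.symm
    · refine hs.not_mul_pow_modEq hq hqo hm ht hso hqs hqt (j := m - d) (by omega) (by omega) ?_
      have h2 := h'.mul_right (q ^ (m - d))
      rw [mul_assoc, ← pow_add, show d + (m - d) = m by omega] at h2
      simpa using h2.trans (hone.mul_left t)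

/-- Odd non-multiples of `q` in the leader range represent distinct `q`-cyclotomic cosets
modulo `q ^ m - 1`, each of size `m`. -/
lemma InLeaderRange.eq_and_eq_of_modEq {q m s t i j : ℕ} (hq : 3 ≤ q) (hqo : Odd q)
    (hm : 2 ≤ m) (hs : InLeaderRange q m s) (ht : InLeaderRange q m t) (hso : Odd s)
    (hto : Odd t) (hqs : ¬ q ∣ s) (hqt : ¬ q ∣ t) (hi : i < m) (hj : j < m)
    (h : s * q ^ i ≡ t * q ^ j [MOD q ^ m - 1]) : s = t ∧ i = j := by
  rcases le_total i j with hij | hij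
  · exact eq_and_eq_of_modEq_of_le hq hqo hm hs ht hso hto hqs hqt hj hij h
  · have := eq_and_eq_of_modEq_of_le hq hqo hm ht hs hto hso hqt hqs hi hij h.symm
    exact ⟨this.1.symm, this.2.symm⟩

/-- Multiplying by powers of `q` moves a small odd number into any window of ratio at least `q`. -/
lemma exists_odd_mul_pow_mem_window {q b M i : ℕ} (hq : 3 ≤ q) (hqo : Odd q)
    (hbM : (1 + 2 * b) * q ≤ M) (hib : i < b) :
    ∃ i' k, b ≤ i' ∧ i' ≤ M ∧ 1 + 2 * i' = (1 + 2 * i) * q ^ k := by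
  classical
  have hex : ∃ k, 1 + 2 * b ≤ (1 + 2 * i) * q ^ k :=
    ⟨1 + 2 * b, (Nat.lt_pow_self (by omega)).le.trans (Nat.le_mul_of_pos_left _ (by omega))⟩
  obtain ⟨k, hk, hmin⟩ : ∃ k, 1 + 2 * b ≤ (1 + 2 * i) * q ^ k ∧
      ∀ l < k, ¬ 1 + 2 * b ≤ (1 + 2 * i) * q ^ l :=
    ⟨Nat.find hex, Nat.find_spec hex, fun _ => Nat.find_min hex⟩
  have hodd : Odd ((1 + 2 * i) * q ^ k) := Odd.mul ⟨i, by ring⟩ hqo.pow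
  obtain ⟨i', hi'⟩ := hodd
  refine ⟨i', k, by omega, ?_, by omega⟩
  rcases k with _ | k
  · rw [pow_zero] at hk
    omega
  · have h1 : (1 + 2 * i) * q ^ k < 1 + 2 * b := not_le.1 (hmin k (by omega))
    have h2 : (1 + 2 * i) * q ^ (k + 1) ≤ (1 + 2 * b) * q := by
      rw [pow_succ, ← mul_assoc]
      exact Nat.mul_le_mul_right _ h1.le
    omega

lemma card_filter_not_dvd_odd_add_div {q : ℕ} (hqo : Odd q) (N : ℕ) :
    ((range N).filter fun i => ¬ q ∣ 1 + 2 * i).card + (N + q / 2) / q = N := by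
  obtain ⟨k, rfl⟩ := hqo
  rw [show (2 * k + 1) / 2 = k by omega]
  induction N with
  | zero => simpa using Nat.div_eq_of_lt (by omega : k < 2 * k + 1)
  | succ N ih =>
    have hiff : (2 * k + 1) ∣ 1 + 2 * N ↔ (2 * k + 1) ∣ N + k + 1 := by
      rw [← Nat.dvd_add_left (dvd_refl (2 * k + 1)),
        show 1 + 2 * N + (2 * k + 1) = 2 * (N + k + 1) by ring]
      exact Nat.Coprime.dvd_mul_left (by simp)
    rw [Finset.range_add_one, Finset.filter_insert, show N + 1 + k = N + k + 1 by ring,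
      Nat.succ_div]
    by_cases hd : (2 * k + 1) ∣ N + k + 1
    · rw [if_neg (not_not.2 (hiff.2 hd)), if_pos hd]
      omega
    · rw [if_pos (mt hiff.1 hd), if_neg hd, Finset.card_insert_of_notMem (by simp)]
      omega

lemma card_filter_not_dvd_odd {q : ℕ} (hqo : Odd q) (M : ℕ) :
    ((range (M + 1)).filter fun i => ¬ q ∣ 1 + 2 * i).card =
      ((2 * M + 1) * (q - 1) + 2 * q - 1) / (2 * q) := by
  have h := card_filter_not_dvd_odd_add_div hqo (M + 1)
  set f := ((range (M + 1)).filter fun i => ¬ q ∣ 1 + 2 * i).card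
  obtain ⟨k, rfl⟩ := hqo
  rw [show (2 * k + 1) / 2 = k by omega] at h
  have hr := Nat.mod_lt (M + 1 + k) (by omega : 2 * k + 1 > 0)
  have hd := Nat.div_add_mod (M + 1 + k) (2 * k + 1)
  set d := (M + 1 + k) / (2 * k + 1)
  set r := (M + 1 + k) % (2 * k + 1)
  have hnum : (2 * M + 1) * (2 * k + 1 - 1) + 2 * (2 * k + 1) - 1
      = 4 * (M * k) + 6 * k + 1 := by
    rw [Nat.add_sub_cancel, show (2 * M + 1) * (2 * k) + 2 * (2 * k + 1)
      = 4 * (M * k) + 6 * k + 1 + 1 by ring, Nat.add_sub_cancel]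
  have hfd : (2 * k + 1) * f + (2 * k + 1) * d = (2 * k + 1) * (M + 1) := by
    rw [← mul_add, h]
  have he : (2 * k + 1) * (M + 1) = 2 * (M * k) + 2 * k + M + 1 := by ring
  have hf : 2 * (2 * k + 1) * f = 2 * ((2 * k + 1) * f) := by ring
  rw [hnum]
  symm
  rw [Nat.div_eq_iff (by omega)]
  rw [mul_comm f, hf]
  omega

end CyclotomicCosets

section Evaluation

variable {F E : Type*} [Field F] [Field E] [Algebra F E]

lemma evalAt_eq_eval (n : ℕ) (x : E) (c : Fin n → F) :
    evalAt F n x c =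
      (∑ j : Fin n, Polynomial.monomial (j : ℕ) (algebraMap F E (c j))).eval x := by
  simp [evalAt, Polynomial.eval_finsetSum, Algebra.smul_def]

/-- Frobenius commutes with evaluation of polynomials over `F`. -/
lemma evalAt_pow_card_pow [Fintype F] (n : ℕ) (x : E) (c : Fin n → F) (k : ℕ) :
    evalAt F n (x ^ Fintype.card F ^ k) c = evalAt F n x c ^ Fintype.card F ^ k := by
  induction k with
  | zero => simp
  | succ k ih =>
    rw [pow_succ, pow_mul, pow_mul, ← ih, ← FiniteField.frobeniusAlgHom_apply F E,
      ← FiniteField.frobeniusAlgHom_apply F E]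
    simp only [evalAt, LinearMap.coe_mk, AddHom.coe_mk, map_sum, map_smul, map_pow]

lemma mem_negaBCH {n : ℕ} {γ : E} {δ b : ℕ} {c : Fin n → F} :
    c ∈ negaBCH F n γ δ b ↔
      ∀ i, b ≤ i → i ≤ b + δ - 2 → evalAt F n (γ ^ (1 + 2 * i)) c = 0 := by
  simp [negaBCH, Submodule.mem_iInf]

/-- A space of words whose polynomials vanish at the distinct points `v k`, `k ∈ T`,
has codimension at least `#T`. -/
lemma finrank_le_sub_card_of_evalAt_eq_zero {n : ℕ} {ι : Type*} (C : Submodule F (Fin n → F))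
    (T : Finset ι) (v : ι → E) (hv : Set.InjOn v T)
    (hC : ∀ c ∈ C, ∀ k ∈ T, evalAt F n (v k) c = 0) :
    Module.finrank F C ≤ n - T.card := by
  classical
  let π : C →ₗ[F] ({j : Fin n // T.card ≤ (j : ℕ)} → F) :=
    (LinearMap.funLeft F F Subtype.val).comp C.subtype
  have hπ : Function.Injective π := by
    rw [injective_iff_map_eq_zero]
    rintro ⟨c, hc⟩ h0
    have hc0 : ∀ j : Fin n, T.card ≤ (j : ℕ) → c j = 0 := fun j hj => congrFun h0 ⟨j, hj⟩
    have hP : (∑ j : Fin n, Polynomial.monomial (j : ℕ) (algebraMap F E (c j))) = 0 := by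
      refine Polynomial.eq_zero_of_degree_lt_of_eval_index_eq_zero T hv ?_
        fun k hk => by rw [← evalAt_eq_eval, hC c hc k hk]
      rw [← Polynomial.mem_degreeLT]
      refine Submodule.sum_mem _ fun j _ => ?_
      rcases lt_or_ge (j : ℕ) T.card with hj | hj
      · exact Polynomial.mem_degreeLT.2
          ((Polynomial.degree_monomial_le _ _).trans_lt (by exact_mod_cast hj))
      · simp [hc0 j hj]
    ext j
    have h1 := congrArg (fun p => Polynomial.coeff p (j : ℕ)) hP
    simpa [Polynomial.finsetSum_coeff, Polynomial.coeff_monomial, Fin.val_inj] using h1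
  refine (LinearMap.finrank_le_finrank_of_injective hπ).trans ?_
  rw [Module.finrank_fintype_fun_eq_card, Fintype.card_subtype]
  have hcompl := Finset.card_filter_add_card_filter_not (s := (Finset.univ : Finset (Fin n)))
    (fun j : Fin n => T.card ≤ (j : ℕ))
  rw [Finset.card_univ, Fintype.card_fin] at hcompl
  have hlow : min n T.card ≤
      ((Finset.univ : Finset (Fin n)).filter fun j : Fin n => ¬ T.card ≤ (j : ℕ)).card := by
    have : min n T.card = (Finset.univ : Finset (Fin (min n T.card))).card := by simp
    rw [this, ← Finset.card_map (Fin.castLEEmb (min_le_left n T.card))]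
    refine Finset.card_le_card fun j hj => ?_
    simp only [Finset.mem_map, Finset.mem_univ, true_and] at hj
    obtain ⟨k, rfl⟩ := hj
    have := k.2
    simp
    omega
  omega

/-- Finitely many functionals with values in the roots of `X ^ (#F ^ m) - X` have joint rank
at most `m` times their number. -/
lemma finrank_range_le_of_pow_eq [Fintype F] {V ι : Type*} [AddCommGroup V] [Module F V]
    [Module.Finite F V] [Fintype ι] (m : ℕ) (hm : m ≠ 0) (f : V →ₗ[F] (ι → E))
    (hf : ∀ v i, f v i ^ Fintype.card F ^ m = f v i) :
    Module.finrank F (LinearMap.range f) ≤ m * Fintype.card ι := by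
  classical
  have hcard : 1 < Fintype.card F := Fintype.one_lt_card
  let P : Polynomial E := Polynomial.X ^ Fintype.card F ^ m - Polynomial.X
  have hP0 : P ≠ 0 := FiniteField.X_pow_card_pow_sub_X_ne_zero E hm hcard
  have hPd : P.natDegree = Fintype.card F ^ m :=
    FiniteField.X_pow_card_pow_sub_X_natDegree_eq E hm hcard
  let R : Finset E := P.roots.toFinset
  have hR : R.card ≤ Fintype.card F ^ m :=
    (Multiset.toFinset_card_le _).trans (hPd ▸ P.card_roots')
  have hsub : (LinearMap.range f : Set (ι → E)) ⊆ ((Fintype.piFinset fun _ => R : Finset (ι → E)) : Set (ι → E)) := by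
    rintro _ ⟨v, rfl⟩
    simp [R, hP0, P, hf v]
  have h1 : Nat.card (LinearMap.range f) ≤ (Fintype.card F ^ m) ^ Fintype.card ι := by
    calc Nat.card (LinearMap.range f)
        = (LinearMap.range f : Set (ι → E)).ncard := rfl
      _ ≤ ((Fintype.piFinset fun _ => R : Finset (ι → E)) : Set (ι → E)).ncard :=
          Set.ncard_le_ncard hsub (Finset.finite_toSet _)
      _ = R.card ^ Fintype.card ι := by rw [Set.ncard_coe_finset]; simp
      _ ≤ _ := Nat.pow_le_pow_left hR _
  rw [Module.natCard_eq_pow_finrank (K := F), Nat.card_eq_fintype_card, ← pow_mul] at h1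
  exact (Nat.pow_le_pow_iff_right hcard).1 h1

end Evaluation

theorem stmt_12 (q m n b δ : ℕ)
    (hq : ∃ p e : ℕ, p.Prime ∧ Odd p ∧ 0 < e ∧ q = p ^ e)
    (hq3 : 3 ≤ q) (hm : 2 ≤ m) (hn : 2 * n = q ^ m - 1)
    (hb : 1 ≤ b) (hδ : 2 ≤ δ)
    (hbδ : 1 + 2 * b ≤ (b + δ - 2) / q)
    (hodd : Odd m → 1 + 2 * (b + δ - 2) ≤ q ^ ((m + 1) / 2) - 1)
    (heven : Even m → 1 + 2 * (b + δ - 2) ≤ 2 * q ^ (m / 2) - 1)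
    (F E : Type*) [Field F] [Fintype F] [Field E] [Algebra F E]
    (hF : Fintype.card F = q)
    (γ : E) (hγ : IsPrimitiveRoot γ (2 * n)) :
    negaBCH F n γ δ b = negaBCH F n γ (b + δ) 0 ∧
    (⋃ i ∈ Set.Icc b (b + δ - 2), qCoset q (2 * n) (1 + 2 * i)) =
      (⋃ i ∈ Set.Icc 0 (b + δ - 2), qCoset q (2 * n) (1 + 2 * i)) ∧
    Module.finrank F (negaBCH F n γ δ b) =
      n - m * (((2 * δ + 2 * b - 3) * (q - 1) + 2 * q - 1) / (2 * q)) := by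
  classical
  have hqo : Odd q := by
    obtain ⟨p, e, -, hp, -, rfl⟩ := hq
    exact hp.pow
  rw [Nat.le_div_iff_mul_le (by omega)] at hbδ
  obtain ⟨M, hM⟩ : ∃ M, M = b + δ - 2 := ⟨_, rfl⟩
  have hnum : 2 * δ + 2 * b - 3 = 2 * M + 1 := by omega
  have hrange : InLeaderRange q m (1 + 2 * M) := ⟨hM ▸ hodd, hM ▸ heven⟩
  have hqm1 : 1 < q ^ m := Nat.one_lt_pow (by omega) (by omega)
  have hzero : ∀ (c : Fin n → F) (s k : ℕ),
      evalAt F n (γ ^ (s * q ^ k)) c = evalAt F n (γ ^ s) c ^ q ^ k := by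
    intro c s k
    rw [← hF, pow_mul, evalAt_pow_card_pow]
  have hzero_iff : ∀ (c : Fin n → F) (s k : ℕ),
      evalAt F n (γ ^ (s * q ^ k)) c = 0 ↔ evalAt F n (γ ^ s) c = 0 := by
    intro c s k
    rw [hzero, pow_eq_zero_iff (pow_ne_zero _ (by omega))]
  have hcode : negaBCH F n γ δ b = negaBCH F n γ (b + δ) 0 := by
    ext c
    rw [mem_negaBCH, mem_negaBCH, zero_add, ← hM]
    refine ⟨fun h i _ hi => ?_, fun h i _ hi => h i (Nat.zero_le i) hi⟩
    rcases le_or_gt b i with hbi | hib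
    · exact h i hbi hi
    · obtain ⟨i', k, hbi', hi', he⟩ := exists_odd_mul_pow_mem_window hq3 hqo (hM ▸ hbδ) hib
      rw [← hzero_iff c _ k, ← he]
      exact h i' hbi' hi'
  refine ⟨hcode, ?_, ?_⟩
  · have hqm : (q : ZMod (2 * n)) ^ m = 1 := by
      have := (ZMod.natCast_eq_natCast_iff _ _ _).2
        (pow_modEq_one_pow_sub_one (by omega : 0 < q) m)
      rw [← hn] at this
      simpa using this
    rw [← hM]
    refine Set.Subset.antisymm
      (Set.biUnion_subset_biUnion_left (Set.Icc_subset_Icc_left (Nat.zero_le b))) ?_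
    refine Set.iUnion₂_subset fun i hi => ?_
    rcases le_or_gt b i with hbi | hib
    · exact Set.subset_biUnion_of_mem (u := fun i => qCoset q (2 * n) (1 + 2 * i)) ⟨hbi, hi.2⟩
    · obtain ⟨i', k, hbi', hi', he⟩ := exists_odd_mul_pow_mem_window hq3 hqo (hM ▸ hbδ) hib
      rintro _ ⟨j, rfl⟩
      refine Set.mem_iUnion₂.2 ⟨i', ⟨hbi', hi'⟩, j + k * (m - 1), ?_⟩
      simp only [he]
      obtain ⟨r, rfl⟩ := Nat.exists_eq_add_of_le' (by omega : 1 ≤ m)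
      rw [Nat.add_sub_cancel, Nat.cast_mul, Nat.cast_pow, mul_assoc, ← pow_add,
        show k + (j + k * r) = j + (r + 1) * k by ring, pow_add, pow_mul, hqm, one_pow, mul_one]
  · rw [hnum, ← card_filter_not_dvd_odd hqo M, hcode]
    set S := (range (M + 1)).filter fun i => ¬ q ∣ 1 + 2 * i with hS
    have hSmem : ∀ i, i ∈ S ↔ i ≤ M ∧ ¬ q ∣ 1 + 2 * i := by
      intro i
      simp [hS]
    let Φ : (Fin n → F) →ₗ[F] (S → E) :=
      LinearMap.pi fun i => evalAt F n (γ ^ (1 + 2 * (i : ℕ)))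
    have hker : negaBCH F n γ (b + δ) 0 = LinearMap.ker Φ := by
      ext c
      rw [mem_negaBCH, zero_add, ← hM, LinearMap.mem_ker, funext_iff]
      refine ⟨fun h i => h i (Nat.zero_le _) ((hSmem _).1 i.2).1, fun h i _ hi => ?_⟩
      obtain ⟨k, s, hs, he⟩ := Nat.exists_eq_pow_mul_and_not_dvd
        (by omega : 1 + 2 * i ≠ 0) q (by omega)
      have hso : Odd s := by
        have : Odd (q ^ k * s) := he ▸ ⟨i, by ring⟩
        exact (Nat.odd_mul.1 this).2
      obtain ⟨l, rfl⟩ := hso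
      have hle : 2 * l + 1 ≤ 1 + 2 * i := by
        rw [he]
        exact Nat.le_mul_of_pos_left _ (Nat.pow_pos (by omega))
      rw [he, mul_comm, hzero_iff, add_comm]
      exact h ⟨l, (hSmem l).2 ⟨by omega, by rwa [add_comm]⟩⟩
    apply le_antisymm
    · have hcardT : m * S.card = (S ×ˢ range m).card := by
        rw [card_product, card_range, mul_comm]
      rw [hcardT]
      refine finrank_le_sub_card_of_evalAt_eq_zero _ _
        (fun x : ℕ × ℕ => γ ^ ((1 + 2 * x.1) * q ^ x.2)) ?_ ?_
      · rintro ⟨s, i⟩ hx ⟨t, j⟩ hy hxy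
        simp only [coe_product, Set.mem_prod, mem_coe, hSmem, mem_range] at hx hy
        have hfin : IsOfFinOrder γ := isOfFinOrder_iff_pow_eq_one.2
          ⟨2 * n, by omega, hγ.pow_eq_one⟩
        have hmod := hfin.pow_eq_pow_iff_modEq.1 hxy
        rw [← hγ.eq_orderOf, hn] at hmod
        have := InLeaderRange.eq_and_eq_of_modEq hq3 hqo hm
          (hrange.mono (by omega)) (hrange.mono (by omega)) ⟨s, by ring⟩ ⟨t, by ring⟩
          hx.1.2 hy.1.2 hx.2 hy.2 hmod
        exact Prod.ext (by simp; omega) this.2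
      · rintro c hc ⟨i, k⟩ hk
        rw [mem_product, hSmem] at hk
        rw [hzero_iff]
        exact mem_negaBCH.1 hc i (Nat.zero_le i) (by simp only at hk; omega)
    · have hΦ : ∀ c i, Φ c i ^ Fintype.card F ^ m = Φ c i := by
        intro c i
        change evalAt F n _ c ^ _ = evalAt F n _ c
        rw [hF, ← hzero, pow_mul', show q ^ m = 2 * n + 1 by omega, pow_succ γ, hγ.pow_eq_one,
          one_mul]
      have h1 := finrank_range_le_of_pow_eq m (by omega) Φ hΦ
      have h2 := LinearMap.finrank_range_add_finrank_ker Φ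
      rw [Module.finrank_fintype_fun_eq_card, Fintype.card_fin] at h2
      rw [Fintype.card_coe] at h1
      rw [hker]
      omega
end
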